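/- For all integers p ≥ 0 and q ≥ 0, there exists f ∈ F such that the commutator [∂_{x_q}, D_p] of ℚ-linear endomorphisms of R equals: q·∂_{x_{p+q−1}} + (1/k)·∂_{t_{(p+q−1)k}} + (1/m)·∂_{t̄_{(p+q−1)m}} + f· if p + q > 1; q·∂_{x_0} + (1/k + 1/m)·(multiplication by x_0) + f· if p + q = 1; (multiplication by t_k + t̄_m) + f· if p = q = 0. -/

import Mathlib

open MvPolynomial

noncomputable section

namespace EBTH

/-- Variables of the polynomial ring: `x n` for `n ≥ 0`, `t n` and `tb n` ("t-bar")
for `n ≥ 1` (indexed by positive naturals). -/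
inductive Var : Type
  | x : ℕ → Var
  | t : {n : ℕ // 0 < n} → Var
  | tb : {n : ℕ // 0 < n} → Var
  deriving DecidableEq

/-- The polynomial algebra `R = ℚ[x₀, x₁, …; t₁, t₂, …; t̄₁, t̄₂, …]`. -/
abbrev P : Type := MvPolynomial Var ℚ

/-- The variable `t n`; intended (and only used) for `n ≥ 1`. -/
def tv (n : ℕ) : Var := Var.t ⟨max n 1, by omega⟩

/-- The variable `t̄ n`; intended (and only used) for `n ≥ 1`. -/
def tbv (n : ℕ) : Var := Var.tb ⟨max n 1, by omega⟩

/-- Multiplication by a polynomial, as a `ℚ`-linear endomorphism. -/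
def mul (f : P) : Module.End ℚ P := LinearMap.mulLeft ℚ f

/-- The partial derivative `∂_v`, as a `ℚ`-linear endomorphism. -/
def pd (v : Var) : Module.End ℚ P := (MvPolynomial.pderiv v).toLinearMap

/-- The commutator `[P,Q] = PQ − QP` of endomorphisms. -/
def comm (f g : Module.End ℚ P) : Module.End ℚ P := f * g - g * f

/-- The first-order (locally finite) part of `D₀`, i.e. the derivation
`(1/k)·Σ_{n≥1}( x_{n+1}·∂_{t_{nk}} + (n+k)·t_{n+k}·∂_{t_n} )
 + (1/m)·Σ_{n≥1}( x_{n+1}·∂_{t̄_{nm}} + (n+m)·t̄_{n+m}·∂_{t̄_n} )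
 + Σ_{n≥1} n·x_n·∂_{x_{n−1}}`,
encoded by its values on the variables. -/
def D0der (k m : ℕ) : Module.End ℚ P :=
  (mkDerivation ℚ fun v => match v with
    | Var.x j => ((j : ℚ) + 1) • X (Var.x (j + 1))
    | Var.t j => (((j : ℚ) + k) / k) • X (tv ((j : ℕ) + k))
        + (if k ∣ (j : ℕ) then (1 / (k : ℚ)) • X (Var.x ((j : ℕ) / k + 1)) else 0)
    | Var.tb j => (((j : ℚ) + m) / m) • X (tbv ((j : ℕ) + m))
        + (if m ∣ (j : ℕ) then (1 / (m : ℚ)) • X (Var.x ((j : ℕ) / m + 1)) else 0)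
  ).toLinearMap

/-- The zero-order part of `D₀`: the polynomial
`(1/(2k))·Σ_{n=1}^{k−1} n(k−n)·t_n t_{k−n} + (1/(2m))·Σ_{n=1}^{m−1} n(m−n)·t̄_n t̄_{m−n}
 + (1/k + 1/m)·x₀x₁ + x₀(t_k + t̄_m)`. -/
def Q0 (k m : ℕ) : P :=
  (1 / (2 * (k : ℚ))) • (∑ i ∈ Finset.range (k - 1),
      (((i : ℚ) + 1) * ((k : ℚ) - ((i : ℚ) + 1))) • (X (tv (i + 1)) * X (tv (k - (i + 1)))))
  + (1 / (2 * (m : ℚ))) • (∑ i ∈ Finset.range (m - 1),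
      (((i : ℚ) + 1) * ((m : ℚ) - ((i : ℚ) + 1))) • (X (tbv (i + 1)) * X (tbv (m - (i + 1)))))
  + ((1 / (k : ℚ)) + (1 / (m : ℚ))) • (X (Var.x 0) * X (Var.x 1))
  + X (Var.x 0) * (X (tv k) + X (tbv m))

/-- The first-order part of `D₁`, i.e. the derivation
`(1/k)·Σ_{n≥1}( x_n·∂_{t_{nk}} + n·t_n·∂_{t_n} )
 + (1/m)·Σ_{n≥1}( x_n·∂_{t̄_{nm}} + n·t̄_n·∂_{t̄_n} ) + Σ_{n≥1} n·x_n·∂_{x_n}`. -/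
def D1der (k m : ℕ) : Module.End ℚ P :=
  (mkDerivation ℚ fun v => match v with
    | Var.x j => (j : ℚ) • X (Var.x j)
    | Var.t j => ((j : ℚ) / k) • X (Var.t j)
        + (if k ∣ (j : ℕ) then (1 / (k : ℚ)) • X (Var.x ((j : ℕ) / k)) else 0)
    | Var.tb j => ((j : ℚ) / m) • X (Var.tb j)
        + (if m ∣ (j : ℕ) then (1 / (m : ℚ)) • X (Var.x ((j : ℕ) / m)) else 0)
  ).toLinearMap

/-- The first-order part of `D_{p+1}` for `p ≥ 1`, i.e. the derivation
`Σ_{n≥1} n·x_n·∂_{x_{p+n}} + (1/k)·Σ_{n≥0}( x_n·∂_{t_{(p+n)k}} + n·t_n·∂_{t_{pk+n}} )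
 + (1/m)·Σ_{n≥0}( x_n·∂_{t̄_{(p+n)m}} + n·t̄_n·∂_{t̄_{pm+n}} )`. -/
def Dbigder (k m p : ℕ) : Module.End ℚ P :=
  (mkDerivation ℚ fun v => match v with
    | Var.x j => if p < j then ((j : ℚ) - (p : ℚ)) • X (Var.x (j - p)) else 0
    | Var.t j =>
        (if k ∣ (j : ℕ) ∧ p ≤ (j : ℕ) / k then
            (1 / (k : ℚ)) • X (Var.x ((j : ℕ) / k - p)) else 0)
        + (if p * k < (j : ℕ) then
            (((j : ℚ) - (p : ℚ) * k) / k) • X (tv ((j : ℕ) - p * k)) else 0)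
    | Var.tb j =>
        (if m ∣ (j : ℕ) ∧ p ≤ (j : ℕ) / m then
            (1 / (m : ℚ)) • X (Var.x ((j : ℕ) / m - p)) else 0)
        + (if p * m < (j : ℕ) then
            (((j : ℚ) - (p : ℚ) * m) / m) • X (tbv ((j : ℕ) - p * m)) else 0)
  ).toLinearMap

/-- The second-order part of `D_{p+1}` for `p ≥ 1`:
`(1/(2k))·Σ_{n=1}^{pk−1} ∂_{t_n}∂_{t_{pk−n}} + (1/(2m))·Σ_{n=1}^{pm−1} ∂_{t̄_n}∂_{t̄_{pm−n}}`. -/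
def Dbig2 (k m p : ℕ) : Module.End ℚ P :=
  (1 / (2 * (k : ℚ))) • (∑ i ∈ Finset.range (p * k - 1),
      pd (tv (i + 1)) * pd (tv (p * k - (i + 1))))
  + (1 / (2 * (m : ℚ))) • (∑ i ∈ Finset.range (p * m - 1),
      pd (tbv (i + 1)) * pd (tbv (p * m - (i + 1))))

/-- The operators `D_p` (`p ≥ 0`) from Section 4.4 of the paper. -/
def D (k m : ℕ) : ℕ → Module.End ℚ P
  | 0 => D0der k m + mul (Q0 k m)
  | 1 => D1der k m
      + mul (((1 / (2 * (k : ℚ))) + (1 / (2 * (m : ℚ)))) • (X (Var.x 0) * X (Var.x 0)))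
  | (p + 2) => Dbigder k m (p + 1) + Dbig2 k m (p + 1)

/-- The subalgebra `F = ℚ[x₁, x₂, …]` of polynomials involving none of the
variables `x₀, t_n, t̄_n`. -/
def Fsub : Subalgebra ℚ P := Algebra.adjoin ℚ (Set.range fun n : ℕ => X (Var.x (n + 1)))

end EBTH

namespace EBTH

theorem tv_of_pos {n : ℕ} (hn : 0 < n) : tv n = Var.t ⟨n, hn⟩ := by
  simp [tv, Nat.max_eq_left hn]

theorem tbv_of_pos {n : ℕ} (hn : 0 < n) : tbv n = Var.tb ⟨n, hn⟩ := by
  simp [tbv, Nat.max_eq_left hn]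

theorem comm_add (f g h : Module.End ℚ P) : comm f (g + h) = comm f g + comm f h := by
  simp only [comm, mul_add, add_mul]
  abel

/-- The commutator of two derivations is determined by its values on the variables. -/
theorem comm_derivation_eq (d₁ d₂ e : Derivation ℚ P P)
    (h : ∀ v, d₁ (d₂ (X v)) - d₂ (d₁ (X v)) = e (X v)) :
    comm d₁.toLinearMap d₂.toLinearMap = e.toLinearMap := by
  have key : ⁅d₁, d₂⁆ = e := MvPolynomial.derivation_ext fun v => by
    rw [Derivation.commutator_apply, h v]
  rw [← key]
  exact LinearMap.ext fun f => (Derivation.commutator_apply f).symm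

theorem comm_pd_mul (v : Var) (f : P) : comm (pd v) (mul f) = mul (pderiv v f) := by
  refine LinearMap.ext fun g => ?_
  change pderiv v (f * g) - f * pderiv v g = pderiv v f * g
  rw [Derivation.leibniz]
  simp only [smul_eq_mul]
  ring

theorem commute_pd (v w : Var) : Commute (pd v) (pd w) := by
  have h : comm (pd v) (pd w) = (0 : Derivation ℚ P P).toLinearMap :=
    comm_derivation_eq _ _ _ fun u => by
      simp [pderiv_X, Pi.single_apply, apply_ite]
  exact sub_eq_zero.mp h

theorem comm_pd_Dbig2 (k m p : ℕ) (v : Var) : comm (pd v) (Dbig2 k m p) = 0 := by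
  refine sub_eq_zero.mpr (Commute.add_right ?_ ?_) <;>
    exact (Commute.sum_right _ _ _ fun i _ =>
      (commute_pd _ _).mul_right (commute_pd _ _)).smul_right _

theorem pderiv_X_ite (v w : Var) : pderiv v (X w : P) = if w = v then 1 else 0 := by
  simp [pderiv_X, Pi.single_apply, eq_comm]

theorem derivation_pderiv_X (d : Derivation ℚ P P) (v w : Var) :
    d (pderiv v (X w : P)) = 0 := by
  rw [pderiv_X_ite]
  split_ifs <;> simp

theorem dvd_and_div_eq_iff {k j a : ℕ} (hk : 0 < k) : (k ∣ j ∧ j / k = a) ↔ j = a * k := by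
  constructor
  · rintro ⟨⟨c, rfl⟩, rfl⟩
    rw [Nat.mul_div_cancel_left _ hk, mul_comm]
  · rintro rfl
    exact ⟨⟨a, mul_comm _ _⟩, Nat.mul_div_cancel _ hk⟩

theorem div_pos_of_dvd {k : ℕ} {j : {n : ℕ // 0 < n}} (h : k ∣ (j : ℕ)) :
    0 < (j : ℕ) / k :=
  Nat.div_pos (Nat.le_of_dvd j.2 h) (Nat.pos_of_dvd_of_pos h j.2)

/-- The derivation `q·∂_{x_a} + (1/k)·∂_{t_{ak}} + (1/m)·∂_{t̄_{am}}`, where the last two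
summands are absent if `a = 0`. -/
def lowering (k m q a : ℕ) : Derivation ℚ P P :=
  mkDerivation ℚ fun v => match v with
    | Var.x j => if j = a then (q : P) else 0
    | Var.t j => if k ∣ (j : ℕ) ∧ (j : ℕ) / k = a then (1 / (k : ℚ)) • 1 else 0
    | Var.tb j => if m ∣ (j : ℕ) ∧ (j : ℕ) / m = a then (1 / (m : ℚ)) • 1 else 0

theorem lowering_toLinearMap {k m a : ℕ} (hk : 0 < k) (hm : 0 < m) (ha : 0 < a) (q : ℕ) :
    (lowering k m q a).toLinearMap = (q : ℚ) • pd (Var.x a)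
      + (1 / (k : ℚ)) • pd (tv (a * k)) + (1 / (m : ℚ)) • pd (tbv (a * m)) := by
  have h : lowering k m q a = (q : ℚ) • pderiv (Var.x a)
      + (1 / (k : ℚ)) • pderiv (tv (a * k)) + (1 / (m : ℚ)) • pderiv (tbv (a * m)) := by
    refine MvPolynomial.derivation_ext fun v => ?_
    rcases v with j | j | j <;>
      simp [lowering, mkDerivation_X, pderiv_X, Pi.single_apply, Subtype.ext_iff,
        tv_of_pos (Nat.mul_pos ha hk), tbv_of_pos (Nat.mul_pos ha hm),
        dvd_and_div_eq_iff hk, dvd_and_div_eq_iff hm, Algebra.smul_def]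
  rw [h]
  rfl

theorem lowering_zero_toLinearMap (k m q : ℕ) :
    (lowering k m q 0).toLinearMap = (q : ℚ) • pd (Var.x 0) := by
  have h : lowering k m q 0 = (q : ℚ) • pderiv (Var.x 0) := by
    refine MvPolynomial.derivation_ext fun v => ?_
    rcases v with j | j | j
    · simp [lowering, mkDerivation_X, pderiv_X, Pi.single_apply, Algebra.smul_def]
    all_goals
      simp only [lowering, mkDerivation_X]
      rw [if_neg fun hj => (div_pos_of_dvd hj.1).ne' hj.2]
      simp [pderiv_X]
  rw [h]
  rfl

theorem comm_pd_D0der (k m q : ℕ) :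
    comm (pd (Var.x q)) (D0der k m) = (lowering k m q (q - 1)).toLinearMap := by
  refine comm_derivation_eq _ _ _ fun v => ?_
  rw [derivation_pderiv_X, sub_zero]
  rcases v with j | j | j
  · simp only [lowering, mkDerivation_X, Derivation.map_smul, pderiv_X_ite, Var.x.injEq]
    rcases q with _ | q
    · simp
    · by_cases h : j = q <;> simp [h, Algebra.smul_def]
  all_goals
    simp only [lowering, mkDerivation_X, map_add, Derivation.map_smul, pderiv_X_ite, tv, tbv,
      apply_ite (pderiv (Var.x q)), map_zero, Var.x.injEq, reduceCtorEq, if_false, smul_zero,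
      zero_add]
    rw [ite_and]
    refine if_ctx_congr Iff.rfl (fun hj => ?_) fun _ => rfl
    have := div_pos_of_dvd hj
    rw [smul_ite, smul_zero]
    exact if_congr (by omega) rfl rfl

theorem comm_pd_D1der (k m q : ℕ) :
    comm (pd (Var.x q)) (D1der k m) = (lowering k m q q).toLinearMap := by
  refine comm_derivation_eq _ _ _ fun v => ?_
  rw [derivation_pderiv_X, sub_zero]
  rcases v with j | j | j
  · simp only [lowering, mkDerivation_X, Derivation.map_smul, pderiv_X_ite, Var.x.injEq]
    by_cases h : j = q <;> simp [h, Algebra.smul_def]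
  all_goals
    simp only [lowering, mkDerivation_X, map_add, Derivation.map_smul, pderiv_X_ite,
      apply_ite (pderiv (Var.x q)), map_zero, Var.x.injEq, reduceCtorEq, if_false, smul_zero,
      zero_add, ite_and, smul_ite]

theorem comm_pd_Dbigder (k m p q : ℕ) :
    comm (pd (Var.x q)) (Dbigder k m p) = (lowering k m q (p + q)).toLinearMap := by
  refine comm_derivation_eq _ _ _ fun v => ?_
  rw [derivation_pderiv_X, sub_zero]
  rcases v with j | j | j
  · simp only [lowering, mkDerivation_X, apply_ite (pderiv (Var.x q)), map_zero,
      Derivation.map_smul, pderiv_X_ite, Var.x.injEq]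
    by_cases h : j = p + q
    · subst h
      rcases q with _ | q <;> simp [Algebra.smul_def]
    · rw [if_neg h]
      split_ifs
      · omega
      all_goals simp
  all_goals
    simp only [lowering, mkDerivation_X, map_add, Derivation.map_smul, pderiv_X_ite, tv, tbv,
      apply_ite (pderiv (Var.x q)), map_zero, Var.x.injEq, reduceCtorEq, if_false, smul_zero,
      add_zero, ite_self, smul_ite, ← ite_and]
    exact if_congr (by rw [and_assoc]; exact and_congr_right fun _ => by omega) rfl rfl

theorem pderiv_x_Q0 (k m q : ℕ) :
    pderiv (Var.x q) (Q0 k m)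
      = if q = 0 then X (tv k) + X (tbv m)
          + ((1 / (k : ℚ)) + (1 / (m : ℚ))) • (X (Var.x 1) : P)
        else if q = 1 then ((1 / (k : ℚ)) + (1 / (m : ℚ))) • (X (Var.x 0) : P) else 0 := by
  simp only [Q0, map_add, Derivation.map_smul, map_sum, Derivation.leibniz, pderiv_X_ite,
    tv, tbv, Var.x.injEq, reduceCtorEq, if_false, smul_zero, add_zero, Finset.sum_const_zero,
    zero_add]
  rcases q with _ | _ | q <;> simp
  ring

theorem mul_add_eq (f g : P) : mul (f + g) = mul f + mul g :=
  map_add (LinearMap.mul ℚ P) f g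

theorem mul_smul_eq (c : ℚ) (f : P) : mul (c • f) = c • mul f :=
  map_smul (LinearMap.mul ℚ P) c f

theorem mul_zero_eq : mul 0 = 0 :=
  map_zero (LinearMap.mul ℚ P)

theorem comm_pd_D_zero_zero (k m : ℕ) :
    comm (pd (Var.x 0)) (D k m 0) = mul (X (tv k) + X (tbv m))
      + mul (((1 / (k : ℚ)) + (1 / (m : ℚ))) • X (Var.x 1)) := by
  rw [D, comm_add, comm_pd_mul, comm_pd_D0der, pderiv_x_Q0, lowering_zero_toLinearMap,
    if_pos rfl, mul_add_eq, Nat.cast_zero, zero_smul, zero_add]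

theorem comm_pd_D_of_add_eq_one {p q : ℕ} (k m : ℕ) (h : p + q = 1) :
    comm (pd (Var.x q)) (D k m p) = (q : ℚ) • pd (Var.x 0)
      + ((1 / (k : ℚ)) + (1 / (m : ℚ))) • mul (X (Var.x 0)) := by
  obtain ⟨rfl, rfl⟩ | ⟨rfl, rfl⟩ : p = 0 ∧ q = 1 ∨ p = 1 ∧ q = 0 := by omega
  · rw [D, comm_add, comm_pd_mul, comm_pd_D0der, pderiv_x_Q0, lowering_zero_toLinearMap,
      if_neg one_ne_zero, if_pos rfl, mul_smul_eq]
  · rw [D, comm_add, comm_pd_mul, comm_pd_D1der, lowering_zero_toLinearMap, ← mul_smul_eq]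
    congr 2
    rw [Derivation.map_smul, Derivation.leibniz, pderiv_X_self, smul_eq_mul, mul_one,
      ← two_smul ℚ, smul_smul]
    congr 1
    ring

theorem comm_pd_D_of_one_lt_add {k m p q : ℕ} (hk : 0 < k) (hm : 0 < m) (h : 1 < p + q) :
    comm (pd (Var.x q)) (D k m p) = (q : ℚ) • pd (Var.x (p + q - 1))
      + (1 / (k : ℚ)) • pd (tv ((p + q - 1) * k))
      + (1 / (m : ℚ)) • pd (tbv ((p + q - 1) * m)) := by
  rw [← lowering_toLinearMap hk hm (by omega)]
  rcases p with _ | _ | p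
  · rw [D, comm_add, comm_pd_mul, comm_pd_D0der, pderiv_x_Q0, if_neg (by omega),
      if_neg (by omega), mul_zero_eq, add_zero, zero_add]
  · have hq : q ≠ 0 := by omega
    rw [D, comm_add, comm_pd_mul, comm_pd_D1der, Derivation.map_smul, Derivation.leibniz,
      pderiv_X_of_ne (by simpa using hq.symm), smul_zero, add_zero, smul_zero, mul_zero_eq,
      add_zero, zero_add, Nat.add_sub_cancel_left]
  · rw [D, comm_add, comm_pd_Dbigder, comm_pd_Dbig2, add_zero,
      show p + 1 + 1 + q - 1 = p + 1 + q by omega]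

end EBTH

open EBTH in
/-- for `p, q ≥ 0`, there exists `f ∈ F` such that `[∂_{x_q}, D_p]` equals
`q·∂_{x_{p+q−1}} + (1/k)·∂_{t_{(p+q−1)k}} + (1/m)·∂_{t̄_{(p+q−1)m}} + f·` if `p + q > 1`;
`q·∂_{x_0} + (1/k + 1/m)·(x₀·) + f·` if `p + q = 1`;
and `((t_k + t̄_m)·) + f·` if `p = q = 0`. -/
theorem stmt7 (k m : ℕ) (hk : 0 < k) (hm : 0 < m) (p q : ℕ) :
    ∃ f ∈ Fsub,
      (1 < p + q →
        comm (pd (Var.x q)) (D k m p)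
          = (q : ℚ) • pd (Var.x (p + q - 1))
            + (1 / (k : ℚ)) • pd (tv ((p + q - 1) * k))
            + (1 / (m : ℚ)) • pd (tbv ((p + q - 1) * m)) + mul f) ∧
      (p + q = 1 →
        comm (pd (Var.x q)) (D k m p)
          = (q : ℚ) • pd (Var.x 0)
            + ((1 / (k : ℚ)) + (1 / (m : ℚ))) • mul (X (Var.x 0)) + mul f) ∧
      (p = 0 → q = 0 →
        comm (pd (Var.x q)) (D k m p)
          = mul (X (tv k) + X (tbv m)) + mul f) := by
  by_cases h : p = 0 ∧ q = 0
  · obtain ⟨rfl, rfl⟩ := h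
    refine ⟨((1 / (k : ℚ)) + (1 / (m : ℚ))) • X (Var.x 1),
      Fsub.smul_mem (Algebra.subset_adjoin ⟨0, rfl⟩) _, by omega, by omega, fun _ _ => ?_⟩
    exact comm_pd_D_zero_zero k m
  · refine ⟨0, Fsub.zero_mem, fun hpq => ?_, fun hpq => ?_, fun hp hq => absurd ⟨hp, hq⟩ h⟩
    · rw [mul_zero_eq, add_zero, comm_pd_D_of_one_lt_add hk hm hpq]
    · rw [mul_zero_eq, add_zero, comm_pd_D_of_add_eq_one k m hpq]
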